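/- Let K be a field of characteristic 0 and let A(X,Y) = Σ_{i+j ≤ deg A} λ_{ij} X^i Y^j ∈ K[X,Y] be irreducible and depend nontrivially on both X and Y. Let r, s be coprime nonzero integers and suppose sX·∂A/∂X − rY·∂A/∂Y = aA for some nonzero a ∈ K. Then λ₀₀ = 0; a is a nonzero integer with si − rj = a for every (i,j) with λ_{ij} ≠ 0; a is divisible by rs; sa > 0 and ra < 0; and, in the case a > 0 (so s > 0 and r < 0), there exist an integer m > 0 and λ₀,…,λ_m ∈ K such that A(X,Y) = Σ_{j=0}^{m} λ_j X^{−r(m−j)} Y^{sj}. -/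

import Mathlib

/-!
STATEMENT 17 (the case `sX·∂A/∂X − rY·∂A/∂Y = aA`, `a ≠ 0`, in the proof of
Lemma 3.14).  `K` is a field of characteristic 0 and `A ∈ K[X,Y]` is modelled by
`MvPolynomial (Fin 2) K` with `X = X 0`, `Y = X 1`.
-/

namespace Stmt17

open MvPolynomial

/-- The exponent vector of the monomial `X^i Y^j`. -/
noncomputable def md (i j : ℕ) : Fin 2 →₀ ℕ :=
  Finsupp.single (0 : Fin 2) i + Finsupp.single (1 : Fin 2) j

theorem md_apply_zero (i j : ℕ) : md i j 0 = i := by simp [md]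

theorem md_apply_one (i j : ℕ) : md i j 1 = j := by simp [md]

theorem md_eta (d : Fin 2 →₀ ℕ) : md (d 0) (d 1) = d := by
  ext k
  fin_cases k
  · exact md_apply_zero _ _
  · exact md_apply_one _ _

theorem coeff_X_mul_pderiv {σ R : Type*} [CommSemiring R] (i : σ) (p : MvPolynomial σ R)
    (d : σ →₀ ℕ) : coeff d (X i * pderiv i p) = (d i : R) * coeff d p := by
  classical
  induction p using MvPolynomial.induction_on' with
  | monomial m c =>
    rw [X_mul_pderiv_monomial, coeff_smul, nsmul_eq_mul, coeff_monomial]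
    split_ifs with h
    · rw [h]
    · simp
  | add p q hp hq => rw [map_add, mul_add, coeff_add, coeff_add, hp, hq, mul_add]

/-- An irreducible polynomial involving a variable other than `X i` has a monomial free of
`X i`. -/
theorem exists_coeff_ne_zero_of_irreducible {σ K : Type*} [Field K] {p : MvPolynomial σ K}
    (hp : Irreducible p) {i j : σ} (hij : j ≠ i) (hj : 0 < p.degreeOf j) :
    ∃ d : σ →₀ ℕ, d i = 0 ∧ coeff d p ≠ 0 := by
  by_contra! h
  have hdvd : X i ∣ p := by
    rw [p.as_sum]
    refine Finset.dvd_sum fun d hd => X_dvd_monomial.mpr (Or.inr fun h0 => ?_)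
    exact mem_support_iff.mp hd (h d h0)
  obtain ⟨q, hq⟩ := (X_prime (R := K) (i := i)).irreducible.dvd_symm hp hdvd
  have hq0 : q ≠ 0 := by
    rintro rfl
    simp at hq
  have hdeg := degreeOf_mul_eq (n := j) hp.ne_zero hq0
  rw [← hq, degreeOf_X_of_ne hij] at hdeg
  omega

theorem euler_type_relation_nonzero
    {K : Type} [Field K] [CharZero K]
    (A : MvPolynomial (Fin 2) K) (hAirr : Irreducible A)
    (hX : 0 < A.degreeOf 0) (hY : 0 < A.degreeOf 1)
    (r s : ℤ) (hr : r ≠ 0) (hs : s ≠ 0) (hcop : IsCoprime r s)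
    (a : K) (ha : a ≠ 0)
    (hrel : C (s : K) * X 0 * pderiv 0 A - C (r : K) * X 1 * pderiv 1 A = C a * A) :
    MvPolynomial.coeff 0 A = 0 ∧
    ∃ n : ℤ, a = (n : K) ∧ n ≠ 0 ∧
      (∀ i j : ℕ, MvPolynomial.coeff (md i j) A ≠ 0 → s * (i : ℤ) - r * (j : ℤ) = n) ∧
      (r * s ∣ n) ∧ 0 < s * n ∧ r * n < 0 ∧
      (0 < n → ∃ m : ℕ, 0 < m ∧ ∃ lam : ℕ → K,
        A = ∑ j ∈ Finset.range (m + 1),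
          monomial (md ((-r).toNat * (m - j)) (s.toNat * j)) (lam j)) := by
  have hcoeff : ∀ d : Fin 2 →₀ ℕ, coeff d A ≠ 0 →
      ((s * (d 0 : ℤ) - r * (d 1 : ℤ) : ℤ) : K) = a := by
    intro d hd
    have h := congrArg (coeff d) hrel
    rw [mul_assoc, mul_assoc, coeff_sub, coeff_C_mul, coeff_C_mul, coeff_C_mul,
      coeff_X_mul_pderiv, coeff_X_mul_pderiv] at h
    apply mul_right_cancel₀ hd
    push_cast
    linear_combination h
  obtain ⟨d, hd0, hd⟩ := exists_coeff_ne_zero_of_irreducible hAirr (i := 0) (j := 1) (by decide) hY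
  obtain ⟨e, he1, he⟩ := exists_coeff_ne_zero_of_irreducible hAirr (i := 1) (j := 0) (by decide) hX
  obtain ⟨n, hn⟩ : ∃ n : ℤ, n = s * (d 0 : ℤ) - r * (d 1 : ℤ) := ⟨_, rfl⟩
  have han : a = (n : K) := by rw [hn, hcoeff d hd]
  have hn0 : n ≠ 0 := by
    rintro rfl
    exact ha (by simpa using han)
  have hline : ∀ f : Fin 2 →₀ ℕ, coeff f A ≠ 0 → s * (f 0 : ℤ) - r * (f 1 : ℤ) = n := by
    intro f hf
    exact_mod_cast (hcoeff f hf).trans han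
  have hnr : n = r * -(d 1 : ℤ) := by rw [hn, hd0]; push_cast; ring
  have hns : n = s * (e 0 : ℤ) := by rw [← hline e he, he1]; push_cast; ring
  have hd1 : (0 : ℤ) < d 1 := by
    have : (d 1 : ℤ) ≠ 0 := fun h => hn0 (by rw [hnr, h]; simp)
    omega
  have he0 : (0 : ℤ) < e 0 := by
    have : (e 0 : ℤ) ≠ 0 := fun h => hn0 (by rw [hns, h]; simp)
    omega
  have hdvd : r * s ∣ n := hcop.mul_dvd ⟨_, hnr⟩ ⟨_, hns⟩
  have hsn : 0 < s * n := by
    rw [hns, ← mul_assoc]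
    exact mul_pos (mul_self_pos.mpr hs) he0
  have hrn : r * n < 0 := by
    have := mul_pos (mul_self_pos.mpr hr) hd1
    rw [hnr]
    linarith
  refine ⟨?_, n, han, hn0, fun i j hij => ?_, hdvd, hsn, hrn, fun hpos => ?_⟩
  · by_contra h
    exact hn0 (by simpa using (hline 0 h).symm)
  · simpa only [md_apply_zero, md_apply_one] using hline _ hij
  have hs0 : 0 < s := pos_of_mul_pos_left hsn hpos.le
  have hr0 : r < 0 := neg_of_mul_neg_left hrn hpos.le
  lift s to ℕ using hs0.le
  obtain ⟨t, rfl⟩ : ∃ t : ℕ, r = -(t : ℤ) := ⟨r.natAbs, by omega⟩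
  rw [neg_neg, Int.toNat_natCast, Int.toNat_natCast]
  have hcop' : Nat.Coprime t s := by
    rw [← Nat.isCoprime_iff_coprime]
    exact (IsCoprime.neg_left_iff _ _).mp hcop
  obtain ⟨m', hm'⟩ : (t * s : ℤ) ∣ n := by simpa [neg_mul] using hdvd
  have hts : (0 : ℤ) < t * s := mul_pos (by omega) hs0
  have hmpos : 0 < m' := by
    rw [hm'] at hpos
    exact pos_of_mul_pos_right hpos hts.le
  lift m' to ℕ using hmpos.le with m
  have hs1 : 0 < s := by exact_mod_cast hs0
  have hexp : ∀ f : Fin 2 →₀ ℕ, coeff f A ≠ 0 → ∃ j ≤ m, md (t * (m - j)) (s * j) = f := by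
    intro f hf
    have h : s * f 0 + t * f 1 = t * s * m := by
      have := hline f hf
      rw [hm'] at this
      zify
      linarith
    obtain ⟨j, hj⟩ : s ∣ f 1 := by
      refine hcop'.symm.dvd_of_dvd_mul_left ((Nat.dvd_add_right (dvd_mul_right s (f 0))).mp ?_)
      rw [h]
      exact ⟨t * m, by ring⟩
    have h2 : f 0 + t * j = t * m := by
      apply Nat.eq_of_mul_eq_mul_left hs1
      rw [hj] at h
      linarith
    have hjm : j ≤ m := by
      have ht : 0 < t := by omega
      exact Nat.le_of_mul_le_mul_left (by omega) ht
    refine ⟨j, hjm, ?_⟩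
    rw [← hj, Nat.mul_sub, ← h2, Nat.add_sub_cancel, md_eta]
  refine ⟨m, by exact_mod_cast hmpos, fun j => coeff (md (t * (m - j)) (s * j)) A, ?_⟩
  ext f
  simp only [coeff_sum, coeff_monomial]
  by_cases hf : coeff f A = 0
  · rw [hf, Finset.sum_eq_zero]
    intro j _
    split_ifs with h
    · rw [h, hf]
    · rfl
  · obtain ⟨j, hjm, hj⟩ := hexp f hf
    rw [Finset.sum_eq_single_of_mem j (Finset.mem_range.mpr (by omega)), if_pos hj, hj]
    intro k _ hkj
    refine if_neg fun hk => hkj (Nat.eq_of_mul_eq_mul_left hs1 ?_)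
    rw [← md_apply_one (t * (m - k)) (s * k), hk, ← hj, md_apply_one]

end Stmt17
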